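/- arXiv:1908.06455 — 8 statements merged into one kernel-verified Lean document; each statement's English description precedes it below -/
import Mathlib

section
/- Let n be a positive integer, let α ∈ (0,π) be non-exceptional, let ℓ > 0 and σ ∈ ℝ. Then 1 is an eigenvalue of the matrix C(α,ℓ,σ)ⁿ (which equals T((α,…,α),(ℓ,…,ℓ),σ), the transfer matrix of the quasi-regular n-gon with all angles α and all side lengths ℓ) if and only if there exists an integer q with 0 ≤ q ≤ ⌊n/2⌋ such that cos(ℓσ) = sin(π²/(2α))·cos(2πq/n). Equivalently, the eigenvalue condition holds if and only if some eigenvalue of C(α,ℓ,σ) is an n-th root of unity, i.e. trace C(α,ℓ,σ) = 2·csc(π²/(2α))·cos(ℓσ) = 2cos(2πq/n) for some integer q. (This is the characterization of quasi-eigenvalues in Proposition 1.16 for quasi-regular curvilinear n-gons.) -/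
open Matrix

/-- The vertex transfer matrix `A(α)` (for non-exceptional `α`). -/
noncomputable def Amat (α : ℝ) : Matrix (Fin 2) (Fin 2) ℂ :=
  !![((Real.sin (Real.pi ^ 2 / (2 * α)))⁻¹ : ℂ),
      -Complex.I * ((Real.cos (Real.pi ^ 2 / (2 * α)) / Real.sin (Real.pi ^ 2 / (2 * α)) : ℝ) : ℂ);
      Complex.I * ((Real.cos (Real.pi ^ 2 / (2 * α)) / Real.sin (Real.pi ^ 2 / (2 * α)) : ℝ) : ℂ),
      ((Real.sin (Real.pi ^ 2 / (2 * α)))⁻¹ : ℂ)]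

/-- The side transfer matrix `B(ℓ,σ) = diag(exp(iℓσ), exp(-iℓσ))`. -/
noncomputable def Bmat (ℓ σ : ℝ) : Matrix (Fin 2) (Fin 2) ℂ :=
  !![Complex.exp (Complex.I * ((ℓ * σ : ℝ) : ℂ)), 0;
      0, Complex.exp (-(Complex.I * ((ℓ * σ : ℝ) : ℂ)))]

/-- `C(α,ℓ,σ) = A(α) · B(ℓ,σ)`. -/
noncomputable def Cmat (α ℓ σ : ℝ) : Matrix (Fin 2) (Fin 2) ℂ := Amat α * Bmat ℓ σ

/-- The transfer matrix `T(α,ℓ,σ) = C(αₙ,ℓₙ,σ) ⋯ C(α₁,ℓ₁,σ)`. -/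
noncomputable def Tmat {n : ℕ} (α ℓ : Fin n → ℝ) (σ : ℝ) : Matrix (Fin 2) (Fin 2) ℂ :=
  ((List.ofFn fun j => Cmat (α j) (ℓ j) σ).reverse).prod

/-- An angle is exceptional if it is of the form `π/(2k)` for a positive integer `k`. -/
def Exceptional (α : ℝ) : Prop := ∃ k : ℕ, 0 < k ∧ α = Real.pi / (2 * (k : ℝ))

theorem Matrix.mem_spectrum_iff_det_sub_eq_zero {m K : Type*} [Fintype m] [DecidableEq m] [Field K]
    (M : Matrix m m K) (μ : K) : μ ∈ spectrum K M ↔ (algebraMap K (Matrix m m K) μ - M).det = 0 := by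
  rw [spectrum.mem_iff, Matrix.isUnit_iff_isUnit_det, isUnit_iff_ne_zero, not_not]

theorem Matrix.exists_mulVec_eq_self_iff_one_mem_spectrum {m K : Type*} [Fintype m] [DecidableEq m]
    [Field K] (M : Matrix m m K) :
    (∃ v : m → K, v ≠ 0 ∧ M.mulVec v = v) ↔ (1 : K) ∈ spectrum K M := by
  rw [Matrix.mem_spectrum_iff_det_sub_eq_zero, ← Matrix.exists_mulVec_eq_zero_iff, map_one]
  simp only [Matrix.sub_mulVec, Matrix.one_mulVec, sub_eq_zero, eq_comm]

theorem Matrix.mem_spectrum_iff_trace_eq {K : Type*} [Field K] (M : Matrix (Fin 2) (Fin 2) K)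
    (hM : M.det = 1) {μ : K} (hμ : μ ≠ 0) : μ ∈ spectrum K M ↔ M.trace = μ + μ⁻¹ := by
  rw [Matrix.mem_spectrum_iff_det_sub_eq_zero]
  have hdet : (algebraMap K (Matrix (Fin 2) (Fin 2) K) μ - M).det
      = μ * (μ + μ⁻¹ - M.trace) := by
    rw [Matrix.det_fin_two] at hM
    simp only [Matrix.det_fin_two, Matrix.trace_fin_two, Matrix.sub_apply,
      Matrix.algebraMap_matrix_apply, Fin.isValue, if_true, zero_ne_one, one_ne_zero, if_false,
      Algebra.algebraMap_self, RingHom.id_apply]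
    linear_combination hM - mul_inv_cancel₀ hμ
  rw [hdet, mul_eq_zero, or_iff_right hμ, sub_eq_zero, eq_comm]

theorem Complex.exp_add_inv_exp_mul_I (x : ℝ) :
    Complex.exp (x * Complex.I) + (Complex.exp (x * Complex.I))⁻¹ = ((2 * Real.cos x : ℝ) : ℂ) := by
  rw [← Complex.exp_neg, Complex.ofReal_mul, Complex.ofReal_cos, Complex.ofReal_ofNat,
    Complex.two_cos, neg_mul]

theorem Matrix.exists_pow_mulVec_eq_self_iff_trace_eq (M : Matrix (Fin 2) (Fin 2) ℂ)
    (hM : M.det = 1) {n : ℕ} (hn : 1 ≤ n) :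
    (∃ v : Fin 2 → ℂ, v ≠ 0 ∧ (M ^ n).mulVec v = v) ↔
      ∃ q : ℕ, q ≤ n / 2 ∧
        M.trace = ((2 * Real.cos (2 * Real.pi * (q : ℝ) / (n : ℝ)) : ℝ) : ℂ) := by
  have hn0 : (n : ℝ) ≠ 0 := Nat.cast_ne_zero.2 (by omega)
  have hn0' : (n : ℂ) ≠ 0 := Nat.cast_ne_zero.2 (by omega)
  rw [Matrix.exists_mulVec_eq_self_iff_one_mem_spectrum, spectrum.map_pow_of_pos M hn]
  constructor
  · rintro ⟨μ, hμ, hμn⟩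
    have : NeZero n := ⟨by omega⟩
    have hμ0 : μ ≠ 0 := by
      rintro rfl
      simp [this.out] at hμn
    obtain ⟨k, hk, hkμ⟩ := (Complex.isPrimitiveRoot_exp n this.out).eq_pow_of_pow_eq_one hμn
    have hexp : μ = Complex.exp ((2 * Real.pi * (k : ℝ) / (n : ℝ) : ℝ) * Complex.I) := by
      rw [← hkμ, ← Complex.exp_nat_mul]
      congr 1
      push_cast
      ring
    have htr := (Matrix.mem_spectrum_iff_trace_eq M hM hμ0).1 hμ
    rw [hexp, Complex.exp_add_inv_exp_mul_I] at htr
    by_cases hkn : k ≤ n / 2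
    · exact ⟨k, hkn, htr⟩
    · refine ⟨n - k, by omega, ?_⟩
      rw [htr, ← Real.cos_two_pi_sub, Nat.cast_sub hk.le]
      congr 3
      field_simp
  · rintro ⟨q, -, hq⟩
    refine ⟨Complex.exp ((2 * Real.pi * (q : ℝ) / (n : ℝ) : ℝ) * Complex.I), ?_, ?_⟩
    · rw [Matrix.mem_spectrum_iff_trace_eq M hM (Complex.exp_ne_zero _),
        Complex.exp_add_inv_exp_mul_I, hq]
    · change _ ^ n = _
      rw [← Complex.exp_nat_mul, Complex.exp_eq_one_iff]
      refine ⟨q, ?_⟩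
      push_cast
      field_simp

theorem sin_ne_zero_of_not_exceptional {α : ℝ} (hα : 0 < α) (hexc : ¬ Exceptional α) :
    Real.sin (Real.pi ^ 2 / (2 * α)) ≠ 0 := by
  intro h
  obtain ⟨k, hk⟩ := Real.sin_eq_zero_iff.1 h
  have hπ := Real.pi_pos
  have hkpos : 0 < k := by
    have : (0 : ℝ) < k * Real.pi := hk ▸ by positivity
    exact_mod_cast pos_of_mul_pos_left this hπ.le
  lift k to ℕ using hkpos.le
  have hk0 : 0 < k := by exact_mod_cast hkpos
  have hkR : (0 : ℝ) < k := by exact_mod_cast hk0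
  refine hexc ⟨k, hk0, ?_⟩
  rw [Int.cast_natCast] at hk
  field_simp at hk ⊢
  linarith

theorem det_Cmat {α : ℝ} (hs : Real.sin (Real.pi ^ 2 / (2 * α)) ≠ 0) (ℓ σ : ℝ) :
    (Cmat α ℓ σ).det = 1 := by
  have hA : (Amat α).det = 1 := by
    rw [Amat, Matrix.det_fin_two_of]
    generalize Real.pi ^ 2 / (2 * α) = x at hs
    have hs' : ((Real.sin x : ℝ) : ℂ) ≠ 0 := Complex.ofReal_ne_zero.2 hs
    have hsq : ((Real.sin x : ℝ) : ℂ) ^ 2 + ((Real.cos x : ℝ) : ℂ) ^ 2 = 1 := by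
      exact_mod_cast Real.sin_sq_add_cos_sq x
    rw [Complex.ofReal_div]
    field_simp
    linear_combination ((Real.cos x : ℝ) : ℂ) ^ 2 * Complex.I_sq - hsq
  have hB : (Bmat ℓ σ).det = 1 := by
    rw [Bmat, Matrix.det_fin_two_of, ← Complex.exp_add]
    simp
  rw [Cmat, Matrix.det_mul, hA, hB, one_mul]

theorem trace_Cmat (α ℓ σ : ℝ) :
    (Cmat α ℓ σ).trace
      = ((2 * (Real.cos (ℓ * σ) / Real.sin (Real.pi ^ 2 / (2 * α))) : ℝ) : ℂ) := by
  have hcos := Complex.two_cos ((ℓ * σ : ℝ) : ℂ)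
  rw [Complex.ofReal_mul, Complex.ofReal_div, Complex.ofReal_cos, Complex.ofReal_ofNat,
    ← mul_div_assoc, hcos, Cmat, Amat, Bmat, Matrix.mul_fin_two, Matrix.trace_fin_two_of]
  rw [mul_comm Complex.I, neg_mul ((ℓ * σ : ℝ) : ℂ)]
  ring

theorem Cmat_pow_eq_Tmat (n : ℕ) (α ℓ σ : ℝ) :
    Cmat α ℓ σ ^ n = Tmat (fun _ : Fin n => α) (fun _ => ℓ) σ := by
  simp [Tmat, List.ofFn_const]

/-- **Proposition 1.16 (quasi-regular polygon).** For a quasi-regular curvilinear `n`-gon with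
non-exceptional angle `α` and side length `ℓ`, whose transfer matrix is `C(α,ℓ,σ)ⁿ`,
`1` is an eigenvalue of `C(α,ℓ,σ)ⁿ` iff `cos(ℓσ) = sin(π²/(2α)) cos(2πq/n)` for some integer
`0 ≤ q ≤ ⌊n/2⌋`; equivalently iff `trace C(α,ℓ,σ) = 2 cos(2πq/n)` for some such `q`. -/
theorem stmt2 (n : ℕ) (hn : 1 ≤ n) (α : ℝ) (hα : α ∈ Set.Ioo 0 Real.pi)
    (hexc : ¬ Exceptional α) (ℓ : ℝ) (hℓ : 0 < ℓ) (σ : ℝ) :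
    Cmat α ℓ σ ^ n = Tmat (fun _ : Fin n => α) (fun _ => ℓ) σ ∧
    ((∃ v : Fin 2 → ℂ, v ≠ 0 ∧ (Cmat α ℓ σ ^ n).mulVec v = v) ↔
      ∃ q : ℕ, q ≤ n / 2 ∧
        Real.cos (ℓ * σ) =
          Real.sin (Real.pi ^ 2 / (2 * α)) * Real.cos (2 * Real.pi * (q : ℝ) / (n : ℝ))) ∧
    ((∃ v : Fin 2 → ℂ, v ≠ 0 ∧ (Cmat α ℓ σ ^ n).mulVec v = v) ↔
      ∃ q : ℕ, q ≤ n / 2 ∧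
        (Cmat α ℓ σ).trace = ((2 * Real.cos (2 * Real.pi * (q : ℝ) / (n : ℝ)) : ℝ) : ℂ)) := by
  have hs := sin_ne_zero_of_not_exceptional hα.1 hexc
  have htrace := Matrix.exists_pow_mulVec_eq_self_iff_trace_eq _ (det_Cmat hs ℓ σ) hn
  refine ⟨Cmat_pow_eq_Tmat n α ℓ σ, htrace.trans (exists_congr fun q => and_congr_right' ?_), htrace⟩
  rw [trace_Cmat, Complex.ofReal_inj, mul_right_inj' two_ne_zero, div_eq_iff hs,
    mul_comm (Real.sin _)]
end

section
/- Let k be a positive integer and α = π/(2k) (so χ_N = π/4 − πk/2 and χ_D = π/4 + πk/2). Viewing G_out(α) and G_in(α) as linear maps ℂ² → ℂ²: the range of G_out(α) is the complex span of X(α); the range of G_in(α) is the complex span of X^⊥(α); the kernel of G_out(α) is the complex span of K^⊥(α) = (1/√2)(1, (−1)^{k+1}); and the kernel of G_in(α) is the complex span of K(α) = (1/√2)(1, (−1)^k). (This is Lemma 3.4 of the paper on the ranges and kernels of the matrices G_out and G_in at exceptional angles.) -/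
open Matrix

/-- `χ_N = π/4 - π²/(4α)`. -/
noncomputable def chiN (α : ℝ) : ℝ := Real.pi / 4 - Real.pi ^ 2 / (4 * α)

/-- `χ_D = π/4 + π²/(4α)`. -/
noncomputable def chiD (α : ℝ) : ℝ := Real.pi / 4 + Real.pi ^ 2 / (4 * α)

/-- `G_out(α) = (1/2)·[[e^{-iχ_N}, e^{-iχ_D}], [e^{iχ_N}, e^{iχ_D}]]`. -/
noncomputable def Gout (α : ℝ) : Matrix (Fin 2) (Fin 2) ℂ :=
  (1 / 2 : ℂ) •
    !![Complex.exp (-(Complex.I * ((chiN α : ℝ) : ℂ))), Complex.exp (-(Complex.I * ((chiD α : ℝ) : ℂ)));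
        Complex.exp (Complex.I * ((chiN α : ℝ) : ℂ)), Complex.exp (Complex.I * ((chiD α : ℝ) : ℂ))]

/-- `G_in(α) = (1/2)·[[e^{iχ_N}, -e^{iχ_D}], [e^{-iχ_N}, -e^{-iχ_D}]]`. -/
noncomputable def Gin (α : ℝ) : Matrix (Fin 2) (Fin 2) ℂ :=
  (1 / 2 : ℂ) •
    !![Complex.exp (Complex.I * ((chiN α : ℝ) : ℂ)), -Complex.exp (Complex.I * ((chiD α : ℝ) : ℂ));
        Complex.exp (-(Complex.I * ((chiN α : ℝ) : ℂ))), -Complex.exp (-(Complex.I * ((chiD α : ℝ) : ℂ)))]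

/-- `X_even = (1/√2)(e^{-iπ/4}, e^{iπ/4})`. -/
noncomputable def Xeven : Fin 2 → ℂ :=
  ![((Real.sqrt 2)⁻¹ : ℂ) * Complex.exp (-(Complex.I * ((Real.pi / 4 : ℝ) : ℂ))),
    ((Real.sqrt 2)⁻¹ : ℂ) * Complex.exp (Complex.I * ((Real.pi / 4 : ℝ) : ℂ))]

/-- `X_odd = (1/√2)(e^{iπ/4}, e^{-iπ/4})`. -/
noncomputable def Xodd : Fin 2 → ℂ :=
  ![((Real.sqrt 2)⁻¹ : ℂ) * Complex.exp (Complex.I * ((Real.pi / 4 : ℝ) : ℂ)),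
    ((Real.sqrt 2)⁻¹ : ℂ) * Complex.exp (-(Complex.I * ((Real.pi / 4 : ℝ) : ℂ)))]

/-- The range of a `2 × 2` matrix whose second column is a multiple of its first one. -/
theorem range_mulVecLin_proportional_columns {K : Type*} [Field K] (a b s : K) :
    LinearMap.range (!![a, s * a; b, s * b] : Matrix (Fin 2) (Fin 2) K).mulVecLin
      = Submodule.span K {![a, b]} := by
  ext v
  simp only [LinearMap.mem_range, Matrix.mulVecLin_apply, Submodule.mem_span_singleton]
  constructor
  · rintro ⟨w, rfl⟩
    refine ⟨w 0 + s * w 1, ?_⟩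
    ext i
    fin_cases i <;> simp [Matrix.mulVec, dotProduct, Fin.sum_univ_two] <;> ring
  · rintro ⟨c, rfl⟩
    refine ⟨![c, 0], ?_⟩
    ext i
    fin_cases i <;> simp [Matrix.mulVec, dotProduct, Fin.sum_univ_two] <;> ring

/-- The kernel of a `2 × 2` matrix whose second column is `s` times its first one, `s ^ 2 = 1`. -/
theorem ker_mulVecLin_proportional_columns {K : Type*} [Field K] {a b s c : K}
    (ha : a ≠ 0) (hs : s ^ 2 = 1) (hc : c ≠ 0) :
    LinearMap.ker (!![a, s * a; b, s * b] : Matrix (Fin 2) (Fin 2) K).mulVecLin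
      = Submodule.span K {![c, c * -s]} := by
  ext v
  simp only [LinearMap.mem_ker, Matrix.mulVecLin_apply, Submodule.mem_span_singleton]
  constructor
  · intro h
    have h0 := congrFun h 0
    simp only [Matrix.mulVec, dotProduct, Fin.sum_univ_two, Matrix.of_apply, Matrix.cons_val_zero,
      Matrix.cons_val_one, Pi.zero_apply] at h0
    have h1 : v 0 + s * v 1 = 0 :=
      (mul_eq_zero.mp (show a * (v 0 + s * v 1) = 0 by linear_combination h0)).resolve_left ha
    refine ⟨v 0 / c, ?_⟩
    ext i
    fin_cases i
    · simp [hc]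
    · simp only [Fin.mk_one, Pi.smul_apply, smul_eq_mul, Matrix.cons_val_one, Matrix.cons_val_fin_one]
      field_simp
      linear_combination -s * h1 + v 1 * hs
  · rintro ⟨d, rfl⟩
    ext i
    fin_cases i <;> simp [Matrix.mulVec, dotProduct, Fin.sum_univ_two]
    · linear_combination -a * d * c * hs
    · linear_combination -b * d * c * hs

theorem chiN_exceptional {k : ℕ} (hk : 0 < k) :
    chiN (Real.pi / (2 * k)) = Real.pi / 4 - k * (Real.pi / 2) := by
  have : (k : ℝ) ≠ 0 := by positivity
  rw [chiN]
  field_simp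
  ring

theorem chiD_exceptional {k : ℕ} (hk : 0 < k) :
    chiD (Real.pi / (2 * k)) = Real.pi / 4 + k * (Real.pi / 2) := by
  have : (k : ℝ) ≠ 0 := by positivity
  rw [chiD]
  field_simp
  ring

theorem exp_natCast_mul_pi_div_two_mul_I (k : ℕ) :
    Complex.exp (k * (Real.pi / 2 * Complex.I)) = Complex.I ^ k := by
  rw [Complex.exp_nat_mul, Complex.exp_pi_div_two_mul_I]

theorem exp_neg_natCast_mul_pi_div_two_mul_I (k : ℕ) :
    Complex.exp (-(k * (Real.pi / 2 * Complex.I))) = (-1) ^ k * Complex.I ^ k := by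
  rw [Complex.exp_neg, exp_natCast_mul_pi_div_two_mul_I, ← inv_pow, Complex.inv_I, neg_pow]

theorem exp_I_mul_pi_div_four :
    Complex.exp (Complex.I * ((Real.pi / 4 : ℝ) : ℂ))
      = Complex.I * Complex.exp (-(Complex.I * ((Real.pi / 4 : ℝ) : ℂ))) := by
  nth_rewrite 2 [← Complex.exp_pi_div_two_mul_I]
  rw [← Complex.exp_add]
  congr 1
  push_cast
  ring

theorem exp_I_mul_chiN {k : ℕ} (hk : 0 < k) :
    Complex.exp (Complex.I * ((chiN (Real.pi / (2 * k)) : ℝ) : ℂ))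
      = Complex.exp (Complex.I * ((Real.pi / 4 : ℝ) : ℂ)) * ((-1) ^ k * Complex.I ^ k) := by
  rw [chiN_exceptional hk, ← exp_neg_natCast_mul_pi_div_two_mul_I, ← Complex.exp_add]
  congr 1
  push_cast
  ring

theorem exp_neg_I_mul_chiN {k : ℕ} (hk : 0 < k) :
    Complex.exp (-(Complex.I * ((chiN (Real.pi / (2 * k)) : ℝ) : ℂ)))
      = Complex.exp (-(Complex.I * ((Real.pi / 4 : ℝ) : ℂ))) * Complex.I ^ k := by
  rw [chiN_exceptional hk, ← exp_natCast_mul_pi_div_two_mul_I, ← Complex.exp_add]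
  congr 1
  push_cast
  ring

theorem exp_I_mul_chiD {k : ℕ} (hk : 0 < k) :
    Complex.exp (Complex.I * ((chiD (Real.pi / (2 * k)) : ℝ) : ℂ))
      = Complex.exp (Complex.I * ((Real.pi / 4 : ℝ) : ℂ)) * Complex.I ^ k := by
  rw [chiD_exceptional hk, ← exp_natCast_mul_pi_div_two_mul_I, ← Complex.exp_add]
  congr 1
  push_cast
  ring

theorem exp_neg_I_mul_chiD {k : ℕ} (hk : 0 < k) :
    Complex.exp (-(Complex.I * ((chiD (Real.pi / (2 * k)) : ℝ) : ℂ)))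
      = Complex.exp (-(Complex.I * ((Real.pi / 4 : ℝ) : ℂ))) * ((-1) ^ k * Complex.I ^ k) := by
  rw [chiD_exceptional hk, ← exp_neg_natCast_mul_pi_div_two_mul_I, ← Complex.exp_add]
  congr 1
  push_cast
  ring

theorem neg_one_pow_sq_eq_one (k : ℕ) : ((-1 : ℂ) ^ k) ^ 2 = 1 := by
  rw [pow_right_comm, neg_one_sq, one_pow]

theorem Gout_exceptional {k : ℕ} (hk : 0 < k) :
    Gout (Real.pi / (2 * k)) =
      letI a := 1 / 2 * Complex.I ^ k * Complex.exp (-(Complex.I * ((Real.pi / 4 : ℝ) : ℂ)))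
      letI b := 1 / 2 * Complex.I ^ k *
        ((-1) ^ k * Complex.exp (Complex.I * ((Real.pi / 4 : ℝ) : ℂ)))
      !![a, (-1) ^ k * a; b, (-1) ^ k * b] := by
  rw [Gout, exp_I_mul_chiN hk, exp_neg_I_mul_chiN hk, exp_I_mul_chiD hk, exp_neg_I_mul_chiD hk]
  have hs := neg_one_pow_sq_eq_one k
  generalize (-1 : ℂ) ^ k = s at *
  generalize Complex.I ^ k = t
  generalize Complex.exp _ = e
  generalize Complex.exp _ = f
  ext i j
  fin_cases i <;> fin_cases j <;> simp <;> grind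

theorem Gin_exceptional {k : ℕ} (hk : 0 < k) :
    Gin (Real.pi / (2 * k)) =
      letI a := 1 / 2 * Complex.I ^ k *
        ((-1) ^ k * Complex.exp (Complex.I * ((Real.pi / 4 : ℝ) : ℂ)))
      letI b := 1 / 2 * Complex.I ^ k * Complex.exp (-(Complex.I * ((Real.pi / 4 : ℝ) : ℂ)))
      !![a, (-1) ^ (k + 1) * a; b, (-1) ^ (k + 1) * b] := by
  rw [Gin, exp_I_mul_chiN hk, exp_neg_I_mul_chiN hk, exp_I_mul_chiD hk, exp_neg_I_mul_chiD hk,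
    pow_succ]
  have hs := neg_one_pow_sq_eq_one k
  generalize (-1 : ℂ) ^ k = s at *
  generalize Complex.I ^ k = t
  generalize Complex.exp _ = e
  generalize Complex.exp _ = f
  ext i j
  fin_cases i <;> fin_cases j <;> simp <;> grind

theorem span_singleton_eq_of_eq_smul {K V : Type*} [Field K] [AddCommGroup V] [Module K V]
    {r : K} (hr : r ≠ 0) {v w : V} (h : v = r • w) :
    Submodule.span K {v} = Submodule.span K {w} := by
  rw [h, Submodule.span_singleton_smul_eq hr.isUnit]

/-- **Lemma 3.4.** For an exceptional angle `α = π/(2k)`: the range of `G_out(α)` is the complex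
span of `X(α)`, the range of `G_in(α)` is the complex span of `X^⊥(α)`, the kernel of `G_out(α)`
is the complex span of `K^⊥(α) = (1/√2)(1, (-1)^{k+1})`, and the kernel of `G_in(α)` is the
complex span of `K(α) = (1/√2)(1, (-1)^k)`. -/
theorem stmt7 (k : ℕ) (hk : 0 < k) :
    LinearMap.range (Gout (Real.pi / (2 * (k : ℝ)))).mulVecLin
        = Submodule.span ℂ {(if Even k then Xeven else Xodd)} ∧
    LinearMap.range (Gin (Real.pi / (2 * (k : ℝ)))).mulVecLin
        = Submodule.span ℂ {(if Even k then Xodd else Xeven)} ∧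
    LinearMap.ker (Gout (Real.pi / (2 * (k : ℝ)))).mulVecLin
        = Submodule.span ℂ
            {(![((Real.sqrt 2)⁻¹ : ℂ), ((Real.sqrt 2)⁻¹ : ℂ) * (-1 : ℂ) ^ (k + 1)] : Fin 2 → ℂ)} ∧
    LinearMap.ker (Gin (Real.pi / (2 * (k : ℝ)))).mulVecLin
        = Submodule.span ℂ
            {(![((Real.sqrt 2)⁻¹ : ℂ), ((Real.sqrt 2)⁻¹ : ℂ) * (-1 : ℂ) ^ k] : Fin 2 → ℂ)} := by
  have hI : (1 / 2 * Complex.I ^ k : ℂ) ≠ 0 := by simp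
  have hc : ((Real.sqrt 2 : ℝ) : ℂ) ≠ 0 := by simp
  have hc' : ((Real.sqrt 2)⁻¹ : ℂ) ≠ 0 := inv_ne_zero hc
  rw [Gout_exceptional hk, Gin_exceptional hk]
  refine ⟨?_, ?_, ?_, ?_⟩
  · rw [range_mulVecLin_proportional_columns]
    rcases Nat.even_or_odd k with h | h
    · rw [if_pos h, h.neg_one_pow, Xeven]
      refine span_singleton_eq_of_eq_smul (mul_ne_zero hI hc) ?_
      ext i
      fin_cases i <;> simp <;> field_simp
    · rw [if_neg (Nat.not_even_iff_odd.mpr h), h.neg_one_pow, Xodd, exp_I_mul_pi_div_four]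
      refine span_singleton_eq_of_eq_smul
        (mul_ne_zero (mul_ne_zero hI hc) (neg_ne_zero.mpr Complex.I_ne_zero)) ?_
      ext i
      fin_cases i <;> simp <;> field_simp
      simp
  · rw [range_mulVecLin_proportional_columns]
    rcases Nat.even_or_odd k with h | h
    · rw [if_pos h, h.neg_one_pow, Xodd]
      refine span_singleton_eq_of_eq_smul (mul_ne_zero hI hc) ?_
      ext i
      fin_cases i <;> simp <;> field_simp
    · rw [if_neg (Nat.not_even_iff_odd.mpr h), h.neg_one_pow, Xeven, exp_I_mul_pi_div_four]
      refine span_singleton_eq_of_eq_smul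
        (mul_ne_zero (mul_ne_zero hI hc) (neg_ne_zero.mpr Complex.I_ne_zero)) ?_
      ext i
      fin_cases i <;> simp <;> field_simp
      simp
  · rw [ker_mulVecLin_proportional_columns (mul_ne_zero hI (Complex.exp_ne_zero _))
      (neg_one_pow_sq_eq_one k) hc', pow_succ, mul_neg_one]
  · rw [ker_mulVecLin_proportional_columns
      (mul_ne_zero hI (mul_ne_zero (by simp) (Complex.exp_ne_zero _)))
      (neg_one_pow_sq_eq_one (k + 1)) hc', pow_succ, mul_neg_one, neg_neg]
end

section
/- Let M be a positive integer and let γ : ℝ → ℝ be (M−1)-times continuously differentiable. Define complex-valued functions ω̃_j : ℝ → ℂ recursively by ω̃₀(s) = i·s and ω̃_j(s) = (i/j)·ω̃'_{j−1}(s) − ((j−1)/j)·γ(s)·ω̃_{j−1}(s) for 1 ≤ j ≤ M. Put Γ(s,t) = 1 + t·γ(s), ω_M(s,t) = Σ_{j=0}^{M} ω̃_j(s)·t^j, and ω̂_M(s) = M·γ(s)·ω̃_M(s) − i·ω̃'_M(s). Then for all (s,t) ∈ ℝ² with Γ(s,t) ≠ 0: ∂_t ω_M(s,t) − i·Γ(s,t)^{−1}·∂_s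 ω_M(s,t) = Γ(s,t)^{−1}·ω̂_M(s)·t^M. (This is the proposition stating that ω_M is an order-M approximate solution of the complex transport equation ∂_t ω = iΓ^{−1}∂_s ω with initial data ω(s,0) = is, used to build approximately harmonic Steklov quasimodes near a curved boundary with curvature γ.) -/
/-- The coefficient functions `ω̃_j` defined recursively by `ω̃₀(s) = is` and
`ω̃_j = (i/j) ω̃'_{j-1} - ((j-1)/j) γ ω̃_{j-1}`. -/
noncomputable def omegaTilde (γ : ℝ → ℝ) : ℕ → ℝ → ℂ
  | 0 => fun s => Complex.I * (s : ℂ)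
  | j + 1 => fun s =>
      Complex.I / ((j : ℂ) + 1) * deriv (omegaTilde γ j) s -
        (j : ℂ) / ((j : ℂ) + 1) * ((γ s : ℝ) : ℂ) * omegaTilde γ j s

theorem omegaTilde_succ_mul (γ : ℝ → ℝ) (j : ℕ) (s : ℝ) :
    ((j : ℂ) + 1) * omegaTilde γ (j + 1) s =
      Complex.I * deriv (omegaTilde γ j) s - (j : ℂ) * (γ s : ℂ) * omegaTilde γ j s := by
  have h : (j : ℂ) + 1 ≠ 0 := Nat.cast_add_one_ne_zero j
  rw [omegaTilde]
  field_simp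

theorem contDiff_omegaTilde {γ : ℝ → ℝ} {k : ℕ} (hγ : ContDiff ℝ k γ) (j : ℕ) :
    ∀ n : ℕ, n + j ≤ k + 2 → ContDiff ℝ n (omegaTilde γ j) := by
  induction j with
  | zero =>
    intro n _
    exact contDiff_const.mul Complex.ofRealCLM.contDiff
  | succ j ih =>
    intro n hn
    have hj : ContDiff ℝ ((n : WithTop ℕ∞) + 1) (omegaTilde γ j) := by
      exact_mod_cast ih (n + 1) (by omega)
    have hd : ContDiff ℝ n (deriv (omegaTilde γ j)) := (contDiff_succ_iff_deriv.1 hj).2.2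
    rcases Nat.eq_zero_or_pos j with rfl | hpos
    · have h : omegaTilde γ (0 + 1) = fun s => Complex.I * deriv (omegaTilde γ 0) s := by
        funext s
        simpa using omegaTilde_succ_mul γ 0 s
      rw [h]
      exact contDiff_const.mul hd
    · have hγn : ContDiff ℝ n γ := hγ.of_le (by exact_mod_cast (by omega : n ≤ k))
      exact (contDiff_const.mul hd).sub
        ((contDiff_const.mul (Complex.ofRealCLM.contDiff.comp hγn)).mul (hj.of_le le_self_add))

theorem sum_transport_telescope {a d : ℕ → ℂ} {g : ℂ}
    (h : ∀ j : ℕ, ((j : ℂ) + 1) * a (j + 1) = Complex.I * d j - (j : ℂ) * g * a j)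
    (t : ℂ) (M : ℕ) :
    (1 + t * g) * ∑ j ∈ Finset.range (M + 1), a j * (j * t ^ (j - 1)) -
        Complex.I * ∑ j ∈ Finset.range (M + 1), d j * t ^ j =
      (M * g * a M - Complex.I * d M) * t ^ M := by
  induction M with
  | zero => simp
  | succ M ih =>
    rw [Finset.sum_range_succ, Finset.sum_range_succ (fun j => d j * t ^ j)]
    simp only [Nat.add_sub_cancel]
    push_cast
    linear_combination ih + t ^ M * h M

/-- `ω_M(s,t) = Σ_{j=0}^{M} ω̃_j(s) tʲ` is an order-`M` approximate solution of the complex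
transport equation `∂_t ω = i Γ⁻¹ ∂_s ω`, `ω(s,0) = is`, where `Γ(s,t) = 1 + tγ(s)`:
`∂_t ω_M - i Γ⁻¹ ∂_s ω_M = Γ⁻¹ ω̂_M(s) t^M` with `ω̂_M(s) = Mγ(s)ω̃_M(s) - i ω̃'_M(s)`. -/
theorem stmt9 (M : ℕ) (hM : 0 < M) (γ : ℝ → ℝ) (hγ : ContDiff ℝ (M - 1 : ℕ) γ)
    (s t : ℝ) (hΓ : 1 + t * γ s ≠ 0) :
    deriv (fun t' : ℝ => ∑ j ∈ Finset.range (M + 1), omegaTilde γ j s * (t' : ℂ) ^ j) t -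
        Complex.I * (((1 + t * γ s : ℝ) : ℂ))⁻¹ *
          deriv (fun s' : ℝ => ∑ j ∈ Finset.range (M + 1), omegaTilde γ j s' * (t : ℂ) ^ j) s =
      (((1 + t * γ s : ℝ) : ℂ))⁻¹ *
        ((M : ℂ) * ((γ s : ℝ) : ℂ) * omegaTilde γ M s - Complex.I * deriv (omegaTilde γ M) s) *
        (t : ℂ) ^ M := by
  have hdiff : ∀ j ∈ Finset.range (M + 1), DifferentiableAt ℝ (omegaTilde γ j) s := by
    intro j hj
    have hj' := Finset.mem_range.1 hj
    exact (contDiff_omegaTilde hγ j 1 (by omega)).differentiable (by simp) s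
  have ht : HasDerivAt
      (fun t' : ℝ => ∑ j ∈ Finset.range (M + 1), omegaTilde γ j s * (t' : ℂ) ^ j)
      (∑ j ∈ Finset.range (M + 1), omegaTilde γ j s * (j * (t : ℂ) ^ (j - 1))) t :=
    HasDerivAt.fun_sum fun j _ => ((hasDerivAt_pow j (t : ℂ)).comp_ofReal).const_mul _
  have hs : HasDerivAt
      (fun s' : ℝ => ∑ j ∈ Finset.range (M + 1), omegaTilde γ j s' * (t : ℂ) ^ j)
      (∑ j ∈ Finset.range (M + 1), deriv (omegaTilde γ j) s * (t : ℂ) ^ j) s :=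
    HasDerivAt.fun_sum fun j hj => (hdiff j hj).hasDerivAt.mul_const _
  have hΓ' : (1 + (t : ℂ) * (γ s : ℂ)) ≠ 0 := by exact_mod_cast hΓ
  have key := sum_transport_telescope (a := fun j => omegaTilde γ j s)
    (fun j => omegaTilde_succ_mul γ j s) (t : ℂ) M
  rw [ht.deriv, hs.deriv]
  push_cast
  rw [mul_assoc (_⁻¹), ← key, mul_sub, inv_mul_cancel_left₀ hΓ']
  ring
end

section
/- Let τ > 0, let w₁ ∈ ℝ² be a unit vector and let w₂ be the rotation of w₁ by π/2. Let S be the symmetric 2×2 real matrix determined by S·w₁ = τ·w₁ and S·w₂ = τ^{−1}·w₂ (so det S = 1). Then for every θ ∈ (−π/2, π/2), setting b = cos(θ)·w₁ + sin(θ)·w₂, one has S·b = r·(cos(θ')·w₁ + sin(θ')·w₂), where θ' = arctan(τ^{−2}·tan(θ)) and r = √(τ²cos²θ + τ^{−2}sin²θ) > 0; in particular |θ' − θ| < π/2. (This is the explicit change-of-argument formula of Lemma 6.2 for the action of a positive symmetric determinant-one matrix, used in the lifted-matrix analysis on the universal cover.) -/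
open Matrix

/-- For `c > 0`, the angle `arctan (c * tan θ)` differs from `θ` by less than a right angle,
since both lie in the same quadrant. -/
theorem abs_arctan_mul_tan_sub_lt {c θ : ℝ} (hc : 0 < c)
    (hθ : θ ∈ Set.Ioo (-(Real.pi / 2)) (Real.pi / 2)) :
    |Real.arctan (c * Real.tan θ) - θ| < Real.pi / 2 := by
  obtain ⟨h₁, h₂⟩ := hθ
  have hl := Real.neg_pi_div_two_lt_arctan (c * Real.tan θ)
  have hu := Real.arctan_lt_pi_div_two (c * Real.tan θ)
  rw [abs_lt]
  rcases le_total 0 θ with h | h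
  · have : 0 ≤ Real.arctan (c * Real.tan θ) :=
      Real.arctan_nonneg.2 (mul_nonneg hc.le (Real.tan_nonneg_of_nonneg_of_le_pi_div_two h h₂.le))
    constructor <;> linarith
  · have : Real.arctan (c * Real.tan θ) ≤ 0 :=
      Real.arctan_le_zero.2 (mul_nonpos_of_nonneg_of_nonpos hc.le
        (Real.tan_nonpos_of_nonpos_of_neg_pi_div_two_le h h₁.le))
    constructor <;> linarith

/-- Polar form of the vector `(a, b)` in the open right half-plane. -/
theorem sqrt_mul_cos_sin_arctan_div {a b : ℝ} (ha : 0 < a) :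
    Real.sqrt (a ^ 2 + b ^ 2) * Real.cos (Real.arctan (b / a)) = a ∧
      Real.sqrt (a ^ 2 + b ^ 2) * Real.sin (Real.arctan (b / a)) = b := by
  have hr : Real.sqrt (a ^ 2 + b ^ 2) = a * Real.sqrt (1 + (b / a) ^ 2) := by
    rw [show a ^ 2 + b ^ 2 = a ^ 2 * (1 + (b / a) ^ 2) by field_simp,
      Real.sqrt_mul (sq_nonneg a), Real.sqrt_sq ha.le]
  have hs : Real.sqrt (1 + (b / a) ^ 2) ≠ 0 := (Real.sqrt_pos.2 (by positivity)).ne'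
  rw [hr, Real.cos_arctan, Real.sin_arctan]
  constructor <;> field_simp

/-- **Lemma 6.2 (explicit change-of-argument formula).** Let `S` be the symmetric 2×2 real matrix
with `S w₁ = τ w₁` and `S w₂ = τ⁻¹ w₂`, where `w₁` is a unit vector, `w₂` its rotation by `π/2`
and `τ > 0` (so `det S = 1`). Then for `θ ∈ (-π/2, π/2)` and `b = cos θ · w₁ + sin θ · w₂`,
`S b = r (cos θ' · w₁ + sin θ' · w₂)` with `θ' = arctan(τ⁻² tan θ)`,
`r = √(τ² cos² θ + τ⁻² sin² θ) > 0`, and `|θ' - θ| < π/2`. -/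
theorem stmt11 (τ : ℝ) (hτ : 0 < τ) (w₁ : Fin 2 → ℝ) (hw : w₁ 0 ^ 2 + w₁ 1 ^ 2 = 1)
    (S : Matrix (Fin 2) (Fin 2) ℝ)
    (hSw₁ : S.mulVec w₁ = τ • w₁)
    (hSw₂ : S.mulVec ![-w₁ 1, w₁ 0] = τ⁻¹ • ![-w₁ 1, w₁ 0]) :
    S.det = 1 ∧
    ∀ θ ∈ Set.Ioo (-(Real.pi / 2)) (Real.pi / 2),
      S.mulVec (Real.cos θ • w₁ + Real.sin θ • ![-w₁ 1, w₁ 0])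
          = Real.sqrt (τ ^ 2 * Real.cos θ ^ 2 + (τ ^ 2)⁻¹ * Real.sin θ ^ 2) •
              (Real.cos (Real.arctan ((τ ^ 2)⁻¹ * Real.tan θ)) • w₁ +
                Real.sin (Real.arctan ((τ ^ 2)⁻¹ * Real.tan θ)) • ![-w₁ 1, w₁ 0]) ∧
        0 < Real.sqrt (τ ^ 2 * Real.cos θ ^ 2 + (τ ^ 2)⁻¹ * Real.sin θ ^ 2) ∧
        |Real.arctan ((τ ^ 2)⁻¹ * Real.tan θ) - θ| < Real.pi / 2 := by
  refine ⟨?_, fun θ hθ => ?_⟩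
  · have hmul : S * !![w₁ 0, -w₁ 1; w₁ 1, w₁ 0]
        = !![τ * w₁ 0, -(τ⁻¹ * w₁ 1); τ * w₁ 1, τ⁻¹ * w₁ 0] := by
      have h₁ := congrFun hSw₁
      have h₂ := congrFun hSw₂
      simp only [Fin.forall_fin_two, Matrix.mulVec, dotProduct, Fin.sum_univ_two, Pi.smul_apply,
        smul_eq_mul, Matrix.cons_val_zero, Matrix.cons_val_one] at h₁ h₂
      ext i j
      fin_cases i <;> fin_cases j <;> simp [Matrix.mul_apply, Fin.sum_univ_two] <;> linarith
    have hdet := congrArg Matrix.det hmul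
    rw [Matrix.det_mul, Matrix.det_fin_two_of, Matrix.det_fin_two_of] at hdet
    have hτ' : τ * τ⁻¹ = 1 := mul_inv_cancel₀ hτ.ne'
    linear_combination hdet - (S.det - τ * τ⁻¹) * hw + hτ'
  · have hcos : 0 < Real.cos θ := Real.cos_pos_of_mem_Ioo hθ
    have hx : (τ ^ 2)⁻¹ * Real.tan θ = (τ⁻¹ * Real.sin θ) / (τ * Real.cos θ) := by
      rw [Real.tan_eq_sin_div_cos]
      field_simp
    have hr : τ ^ 2 * Real.cos θ ^ 2 + (τ ^ 2)⁻¹ * Real.sin θ ^ 2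
        = (τ * Real.cos θ) ^ 2 + (τ⁻¹ * Real.sin θ) ^ 2 := by
      rw [mul_pow, mul_pow, inv_pow]
    obtain ⟨hc, hs⟩ := sqrt_mul_cos_sin_arctan_div (b := τ⁻¹ * Real.sin θ) (mul_pos hτ hcos)
    refine ⟨?_, Real.sqrt_pos.2 (by positivity), abs_arctan_mul_tan_sub_lt (by positivity) hθ⟩
    rw [Matrix.mulVec_add, Matrix.mulVec_smul, Matrix.mulVec_smul, hSw₁, hSw₂, hr, hx, smul_add,
      smul_smul, smul_smul, smul_smul, smul_smul, hc, hs, mul_comm τ, mul_comm τ⁻¹]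
end

section
/- Let φ₁, φ₂ : ℝ → ℝ be continuously differentiable functions and suppose there are constants C₁, C₂ with 0 < C₁ ≤ φ'_i(σ) ≤ C₂ for all σ ∈ ℝ and i = 1, 2. Then there exists δ > 0 such that for every M ∈ ℝ there exist intervals I ⊂ (M, ∞) and I' ⊂ (M, ∞), each of length δ, such that ⌊φ₁(σ)⌋ + ⌊φ₂(σ)⌋ + 1 = ⌊φ₁(σ) + φ₂(σ)⌋ for all σ ∈ I, and ⌊φ₁(σ)⌋ + ⌊φ₂(σ)⌋ = ⌊φ₁(σ) + φ₂(σ)⌋ for all σ ∈ I'. (This is Proposition 6.x (prop:integparts) of the paper, the key real-analysis step in gluing quasi-eigenvalue counting functions of zigzags.) -/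
theorem floor_add_floor_add_one_eq {x y : ℝ} {n m : ℤ} (hxn : n ≤ x) (hxn' : x < n + 1)
    (hym : m ≤ y) (hym' : y < m + 1) (hxy : n + m + 1 ≤ x + y) :
    ⌊x⌋ + ⌊y⌋ + 1 = ⌊x + y⌋ := by
  rw [Int.floor_eq_iff.2 ⟨hxn, hxn'⟩, Int.floor_eq_iff.2 ⟨hym, hym'⟩, eq_comm, Int.floor_eq_iff]
  push_cast
  constructor <;> linarith

theorem floor_add_floor_eq {x y : ℝ} {n m : ℤ} (hxn : n ≤ x) (hym : m ≤ y)
    (hxy : x + y < n + m + 1) : ⌊x⌋ + ⌊y⌋ = ⌊x + y⌋ := by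
  have hx : ⌊x⌋ = n := Int.floor_eq_iff.2 ⟨hxn, by linarith⟩
  have hy : ⌊y⌋ = m := Int.floor_eq_iff.2 ⟨hym, by linarith⟩
  rw [hx, hy, eq_comm, Int.floor_eq_iff]
  push_cast
  constructor <;> linarith

/-- A continuous function that grows at least linearly is surjective. -/
theorem surjective_of_mul_sub_le {f : ℝ → ℝ} {C : ℝ} (hC : 0 < C) (hf : Continuous f)
    (hl : ∀ x y, x ≤ y → C * (y - x) ≤ f y - f x) : Function.Surjective f := by
  intro v
  have h0 : 0 ≤ |v - f 0| / C := by positivity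
  have hm : C * (|v - f 0| / C) = |v - f 0| := by field_simp
  refine mem_range_of_exists_le_of_exists_ge hf ⟨-(|v - f 0| / C), ?_⟩ ⟨|v - f 0| / C, ?_⟩
  · have := hl (-(|v - f 0| / C)) 0 (by linarith)
    have := neg_abs_le (v - f 0)
    linarith
  · have := hl 0 (|v - f 0| / C) h0
    have := le_abs_self (v - f 0)
    linarith


/-- **Proposition on integer parts.** If `φ₁, φ₂` are `C¹` with `0 < C₁ ≤ φᵢ' ≤ C₂`, then there
is `δ > 0` such that arbitrarily far to the right there are intervals of length `δ` on which
`⌊φ₁⌋ + ⌊φ₂⌋ + 1 = ⌊φ₁ + φ₂⌋`, and intervals of length `δ` on which `⌊φ₁⌋ + ⌊φ₂⌋ = ⌊φ₁ + φ₂⌋`. -/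
theorem stmt12 (φ₁ φ₂ : ℝ → ℝ) (C₁ C₂ : ℝ) (hC₁ : 0 < C₁)
    (h₁ : ContDiff ℝ 1 φ₁) (h₂ : ContDiff ℝ 1 φ₂)
    (hd₁ : ∀ σ : ℝ, C₁ ≤ deriv φ₁ σ ∧ deriv φ₁ σ ≤ C₂)
    (hd₂ : ∀ σ : ℝ, C₁ ≤ deriv φ₂ σ ∧ deriv φ₂ σ ≤ C₂) :
    ∃ δ > 0, ∀ M : ℝ,
      (∃ a, M < a ∧ ∀ σ ∈ Set.Icc a (a + δ),
        ⌊φ₁ σ⌋ + ⌊φ₂ σ⌋ + 1 = ⌊φ₁ σ + φ₂ σ⌋) ∧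
      (∃ a, M < a ∧ ∀ σ ∈ Set.Icc a (a + δ),
        ⌊φ₁ σ⌋ + ⌊φ₂ σ⌋ = ⌊φ₁ σ + φ₂ σ⌋) := by
  have hC₂ : 0 < C₂ := hC₁.trans_le ((hd₁ 0).1.trans (hd₁ 0).2)
  have hC : C₁ ≤ C₂ := (hd₁ 0).1.trans (hd₁ 0).2
  have D₁ := h₁.differentiable one_ne_zero
  have D₂ := h₂.differentiable one_ne_zero
  have l₁ : ∀ x y, x ≤ y → C₁ * (y - x) ≤ φ₁ y - φ₁ x := fun x y h =>
    mul_sub_le_image_sub_of_le_deriv D₁ (fun z => (hd₁ z).1) h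
  have l₂ : ∀ x y, x ≤ y → C₁ * (y - x) ≤ φ₂ y - φ₂ x := fun x y h =>
    mul_sub_le_image_sub_of_le_deriv D₂ (fun z => (hd₂ z).1) h
  have u₁ : ∀ x y, x ≤ y → φ₁ y - φ₁ x ≤ C₂ * (y - x) := fun x y h =>
    image_sub_le_mul_sub_of_deriv_le D₁ (fun z => (hd₁ z).2) h
  have u₂ : ∀ x y, x ≤ y → φ₂ y - φ₂ x ≤ C₂ * (y - x) := fun x y h =>
    image_sub_le_mul_sub_of_deriv_le D₂ (fun z => (hd₂ z).2) h
  have m₁ : StrictMono φ₁ := fun x y h => by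
    have := l₁ x y h.le
    have := mul_pos hC₁ (sub_pos.2 h)
    linarith
  have m₂ : StrictMono φ₂ := fun x y h => by
    have := l₂ x y h.le
    have := mul_pos hC₁ (sub_pos.2 h)
    linarith
  have s₁ := surjective_of_mul_sub_le hC₁ h₁.continuous l₁
  have s₂ := surjective_of_mul_sub_le hC₁ h₂.continuous l₂
  obtain ⟨d, hd, hKd⟩ : ∃ d : ℝ, 0 < d ∧ C₂ * d = 1 / 8 :=
    ⟨1 / (8 * C₂), by positivity, by field_simp⟩
  obtain ⟨δ, hδ, hKδ⟩ : ∃ δ : ℝ, 0 < δ ∧ C₂ * δ = C₁ * d / 4 :=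
    ⟨C₁ * d / (4 * C₂), by positivity, by field_simp⟩
  have hε : 0 < C₁ * d := mul_pos hC₁ hd
  have hε' : C₁ * d ≤ 1 / 8 := hKd ▸ mul_le_mul_of_nonneg_right hC hd.le
  refine ⟨δ, hδ, fun M => ?_⟩
  obtain ⟨t, ht⟩ := s₁ ((⌊φ₁ (M + d + 2 * δ)⌋ + 1 : ℤ) : ℝ)
  generalize hn : ⌊φ₁ (M + d + 2 * δ)⌋ + 1 = n at ht
  have htM : M + d + 2 * δ < t := by
    rw [← m₁.lt_iff_lt, ht, ← hn]
    push_cast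
    exact Int.lt_floor_add_one _
  obtain ⟨m, hm⟩ : ∃ m : ℤ, m = ⌊φ₂ t⌋ := ⟨_, rfl⟩
  obtain ⟨hm₁, hm₂⟩ := Int.floor_eq_iff.1 hm.symm
  constructor
  · rcases lt_or_ge (φ₂ t) (m + C₁ * d) with hy | hy
    · obtain ⟨s, hs⟩ := s₂ m
      have hst : s ≤ t := m₂.le_iff_le.1 (by linarith)
      have hsd : t - s < d := lt_of_mul_lt_mul_left (by linarith [l₂ s t hst]) hC₁.le
      have hK : C₂ * (t - s) ≤ C₂ * d := by gcongr
      refine ⟨s - 2 * δ, by linarith, fun σ ⟨ha, hb⟩ => ?_⟩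
      have hσ : C₂ * (s - σ) ≤ C₂ * (2 * δ) := by gcongr; linarith
      have := m₂ (show σ < s by linarith)
      have := m₁ (show σ < t by linarith)
      have := u₁ s t hst
      have := u₁ σ s (by linarith)
      have := u₂ σ s (by linarith)
      apply floor_add_floor_add_one_eq (n := n - 1) (m := m - 1) <;> push_cast <;> linarith
    · refine ⟨t - 2 * δ, by linarith, fun σ ⟨ha, hb⟩ => ?_⟩
      have hσ : C₂ * (t - σ) ≤ C₂ * (2 * δ) := by gcongr; linarith
      have := m₂ (show σ < t by linarith)
      have := m₁ (show σ < t by linarith)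
      have := u₁ σ t (by linarith)
      have := u₂ σ t (by linarith)
      apply floor_add_floor_add_one_eq (n := n - 1) (m := m) <;> push_cast <;> linarith
  · rcases lt_or_ge (m + 1 - C₁ * d) (φ₂ t) with hy | hy
    · obtain ⟨s, hs⟩ := s₂ (m + 1)
      have hst : t ≤ s := m₂.le_iff_le.1 (by linarith)
      have hsd : s - t < d := lt_of_mul_lt_mul_left (by linarith [l₂ t s hst]) hC₁.le
      have hK : C₂ * (s - t) ≤ C₂ * d := by gcongr
      refine ⟨s, by linarith, fun σ ⟨ha, hb⟩ => ?_⟩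
      have hσ : C₂ * (σ - s) ≤ C₂ * δ := by gcongr; linarith
      have := m₂.monotone ha
      have := m₁.monotone (hst.trans ha)
      have := u₁ t s hst
      have := u₁ s σ ha
      have := u₂ s σ ha
      apply floor_add_floor_eq (n := n) (m := m + 1) <;> push_cast <;> linarith
    · refine ⟨t, by linarith, fun σ ⟨ha, hb⟩ => ?_⟩
      have hσ : C₂ * (σ - t) ≤ C₂ * δ := by gcongr; linarith
      have := m₂.monotone ha
      have := m₁.monotone ha
      have := u₁ t σ ha
      have := u₂ t σ ha
      apply floor_add_floor_eq (n := n) (m := m) <;> linarith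
end

section
/- Let n ≥ 1, let α = (α₁,…,αₙ) ∈ (0,π)ⁿ (exceptional angles allowed), ℓ ∈ (0,∞)ⁿ and σ ∈ ℝ; write α' = (α₁,…,α_{n−1}) and ℓ' = (ℓ₁,…,ℓ_{n−1}). Define Fₙ(α,ℓ,σ) = Σ_{ζ∈{±1}ⁿ, ζ₁=1} 𝔭_ζ(α)·exp(i(ℓ·ζ)σ) and F̃ₙ(α,ℓ,σ) = −i·Σ_{ζ∈{±1}ⁿ, ζ₁=1} 𝔮_ζ(α)·exp(−i(ℓ·ζ)σ), with the conventions F₀ = 1 and F̃₀ = 0. Then the recurrence relations hold: Fₙ(α,ℓ,σ) = exp(iℓₙσ)·F_{n−1}(α',ℓ',σ) − i·cos(π²/(2αₙ))·exp(−iℓₙσ)·conj(F̃_{n−1}(α',ℓ',σ)), and F̃ₙ(α,ℓ,σ) = exp(iℓₙσ)·F̃_{n−1}(α',ℓ',σ) − i·cos(π²/(2αₙ))·exp(−iℓₙσ)·conj(F_{n−1}(α',ℓ',σ)). (This is Proposition 7.3 of the paper.) -/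
/-- Cyclic successor on `Fin n`. -/
def cyc {n : ℕ} (j : Fin n) : Fin n :=
  ⟨(j.val + 1) % n, Nat.mod_lt _ (Nat.lt_of_le_of_lt (Nat.zero_le _) j.isLt)⟩

/-- The sign vector `ζ ∈ {±1}ⁿ` encoded by `ε : Fin n → Bool`. -/
def sgnB {n : ℕ} (ε : Fin n → Bool) (j : Fin n) : ℝ := if ε j then 1 else -1

/-- Sign vectors `ζ ∈ {±1}ⁿ` with `ζ₁ = 1`. -/
def zSet (n : ℕ) : Finset (Fin n → Bool) :=
  Finset.univ.filter fun ε => ∀ j : Fin n, (j : ℕ) = 0 → ε j = true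

/-- The dot product `ℓ · ζ`. -/
noncomputable def dotSgn {n : ℕ} (ℓ : Fin n → ℝ) (ε : Fin n → Bool) : ℝ :=
  ∑ j, ℓ j * sgnB ε j

/-- `𝔭_ζ(α) = ∏_{j ∈ Ch(ζ)} cos(π²/(2α_j))`, where `Ch(ζ)` is the set of indices of sign change
of `ζ`, with the cyclic convention `ζ_{n+1} = ζ₁`. -/
noncomputable def pCoef {n : ℕ} (α : Fin n → ℝ) (ε : Fin n → Bool) : ℝ :=
  ∏ j ∈ Finset.univ.filter (fun j : Fin n => ε j ≠ ε (cyc j)),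
    Real.cos (Real.pi ^ 2 / (2 * α j))

/-- The padded successor value: `ζ_{j+1}` where the padding convention `ζ_{n+1} := -1`
(encoded as `false`) is used. -/
def nextPad {n : ℕ} (ε : Fin n → Bool) (j : Fin n) : Bool :=
  if h : j.val + 1 < n then ε ⟨j.val + 1, h⟩ else false

/-- `𝔮_ζ(α) = ∏_{j ∈ C̃h(ζ)} cos(π²/(2α_j))`, where `C̃h(ζ)` is the set of indices of sign change
of `ζ` padded by `ζ_{n+1} := -1`. -/
noncomputable def qCoef {n : ℕ} (α : Fin n → ℝ) (ε : Fin n → Bool) : ℝ :=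
  ∏ j ∈ Finset.univ.filter (fun j : Fin n => ε j ≠ nextPad ε j),
    Real.cos (Real.pi ^ 2 / (2 * α j))

/-- `Fₙ(α,ℓ,σ) = Σ_{ζ ∈ {±1}ⁿ, ζ₁=1} 𝔭_ζ(α) exp(i(ℓ·ζ)σ)` (with the convention `F₀ = 1`). -/
noncomputable def Fc {n : ℕ} (α ℓ : Fin n → ℝ) (σ : ℝ) : ℂ :=
  ∑ ε ∈ zSet n, ((pCoef α ε : ℝ) : ℂ) *
    Complex.exp (Complex.I * ((dotSgn ℓ ε * σ : ℝ) : ℂ))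

/-- `F̃ₙ(α,ℓ,σ) = -i Σ_{ζ ∈ {±1}ⁿ, ζ₁=1} 𝔮_ζ(α) exp(-i(ℓ·ζ)σ)` with the convention `F̃₀ = 0`. -/
noncomputable def Ftc {n : ℕ} (α ℓ : Fin n → ℝ) (σ : ℝ) : ℂ :=
  if n = 0 then 0
  else
    -Complex.I * ∑ ε ∈ zSet n, ((qCoef α ε : ℝ) : ℂ) *
      Complex.exp (-(Complex.I * ((dotSgn ℓ ε * σ : ℝ) : ℂ)))

/-- The product of `cos(π²/(2α_j))` over the indices of sign change of `ε`, padded by `b`. -/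
noncomputable def padCoef (b : Bool) {n : ℕ} (α : Fin n → ℝ) (ε : Fin n → Bool) : ℝ :=
  ∏ j : Fin n, if ε j ≠ (if h : j.val + 1 < n then ε ⟨j.val + 1, h⟩ else b) then
    Real.cos (Real.pi ^ 2 / (2 * α j)) else 1

theorem qCoef_eq_padCoef {n : ℕ} (α : Fin n → ℝ) (ε : Fin n → Bool) :
    qCoef α ε = padCoef false α ε := by
  rw [qCoef, Finset.prod_filter]
  rfl

theorem pCoef_eq_padCoef {n : ℕ} (α : Fin n → ℝ) {ε : Fin n → Bool} (hε : ε ∈ zSet n) :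
    pCoef α ε = padCoef true α ε := by
  have hcyc (j : Fin n) :
      ε (cyc j) = if h : j.val + 1 < n then ε ⟨j.val + 1, h⟩ else true := by
    split_ifs with h
    · congr 1
      exact Fin.ext (Nat.mod_eq_of_lt h)
    · refine (Finset.mem_filter.mp hε).2 (cyc j) ?_
      have : j.val + 1 = n := by omega
      simp [cyc, this]
  simp only [pCoef, padCoef, Finset.prod_filter, hcyc]

theorem padCoef_snoc (b d : Bool) {n : ℕ} (α : Fin (n + 1) → ℝ) (ε : Fin n → Bool) :
    padCoef b α (Fin.snoc ε d : Fin (n + 1) → Bool) =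
      padCoef d (α ∘ Fin.castSucc) ε *
        if d ≠ b then Real.cos (Real.pi ^ 2 / (2 * α (Fin.last n))) else 1 := by
  have hnext (j : Fin n) :
      (Fin.snoc ε d : Fin (n + 1) → Bool) ⟨j.val + 1, by omega⟩ =
        if h : j.val + 1 < n then ε ⟨j.val + 1, h⟩ else d := by
    simp [Fin.snoc]
  simp [padCoef, Fin.prod_univ_castSucc, hnext]

theorem dotSgn_snoc (d : Bool) {n : ℕ} (ℓ : Fin (n + 1) → ℝ) (ε : Fin n → Bool) :
    dotSgn ℓ (Fin.snoc ε d : Fin (n + 1) → Bool) =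
      dotSgn (ℓ ∘ Fin.castSucc) ε + ℓ (Fin.last n) * if d then 1 else -1 := by
  simp [dotSgn, sgnB, Fin.sum_univ_castSucc]

theorem snoc_mem_zSet (d : Bool) {n : ℕ} {ε : Fin (n + 1) → Bool} :
    (Fin.snoc ε d : Fin (n + 2) → Bool) ∈ zSet (n + 2) ↔ ε ∈ zSet (n + 1) := by
  simp [zSet, Fin.snoc]

theorem sum_zSet_succ {M : Type*} [AddCommMonoid M] {n : ℕ} (f : (Fin (n + 2) → Bool) → M) :
    ∑ ε ∈ zSet (n + 2), f ε =
      ∑ ε ∈ zSet (n + 1), f (Fin.snoc ε true) + ∑ ε ∈ zSet (n + 1), f (Fin.snoc ε false) := by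
  have hsum : ∀ (k : ℕ) (g : (Fin k → Bool) → M),
      ∑ ε ∈ zSet k, g ε = ∑ ε, if ε ∈ zSet k then g ε else 0 := fun k g => by
    rw [← Finset.sum_filter, Finset.filter_univ_mem]
  rw [hsum, hsum, hsum, ← (Fin.snocEquiv fun _ => Bool).sum_comp, Fintype.sum_prod_type,
    Fintype.sum_bool]
  simp only [Fin.snocEquiv, Equiv.coe_fn_mk, snoc_mem_zSet]

/-- The sum of `padCoef b α ε * exp(i(ℓ·ζ)σ)` over the sign vectors with first entry `1`. -/
noncomputable def padSum (b : Bool) {n : ℕ} (α ℓ : Fin n → ℝ) (σ : ℝ) : ℂ :=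
  ∑ ε ∈ zSet n, ((padCoef b α ε : ℝ) : ℂ) *
    Complex.exp (Complex.I * ((dotSgn ℓ ε * σ : ℝ) : ℂ))

theorem padSum_succ (b : Bool) {n : ℕ} (α ℓ : Fin (n + 2) → ℝ) (σ : ℝ) :
    padSum b α ℓ σ =
      (if b then 1 else ((Real.cos (Real.pi ^ 2 / (2 * α (Fin.last (n + 1)))) : ℝ) : ℂ)) *
          Complex.exp (Complex.I * ((ℓ (Fin.last (n + 1)) * σ : ℝ) : ℂ)) *
          padSum true (α ∘ Fin.castSucc) (ℓ ∘ Fin.castSucc) σ +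
        (if b then ((Real.cos (Real.pi ^ 2 / (2 * α (Fin.last (n + 1)))) : ℝ) : ℂ) else 1) *
          Complex.exp (-(Complex.I * ((ℓ (Fin.last (n + 1)) * σ : ℝ) : ℂ))) *
          padSum false (α ∘ Fin.castSucc) (ℓ ∘ Fin.castSucc) σ := by
  have hexp (x y s : ℝ) : Complex.exp (Complex.I * (((x + y * s) * σ : ℝ) : ℂ)) =
      Complex.exp (s * (Complex.I * ((y * σ : ℝ) : ℂ))) *
        Complex.exp (Complex.I * ((x * σ : ℝ) : ℂ)) := by
    rw [← Complex.exp_add]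
    congr 1
    push_cast
    ring
  simp only [padSum, sum_zSet_succ, Finset.mul_sum, padCoef_snoc, dotSgn_snoc, hexp,
    Complex.ofReal_mul (padCoef _ _ _)]
  congr 1 <;> refine Finset.sum_congr rfl fun ε _ => ?_ <;> cases b <;> simp <;> ring

theorem Fc_eq_padSum {n : ℕ} (α ℓ : Fin n → ℝ) (σ : ℝ) : Fc α ℓ σ = padSum true α ℓ σ :=
  Finset.sum_congr rfl fun ε hε => by rw [pCoef_eq_padCoef α hε]

theorem Ftc_eq_padSum {n : ℕ} (α ℓ : Fin (n + 1) → ℝ) (σ : ℝ) :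
    Ftc α ℓ σ = -Complex.I * padSum false α ℓ (-σ) := by
  simp [Ftc, padSum, qCoef_eq_padCoef]

theorem conj_padSum (b : Bool) {n : ℕ} (α ℓ : Fin n → ℝ) (σ : ℝ) :
    starRingEnd ℂ (padSum b α ℓ σ) = padSum b α ℓ (-σ) := by
  simp [padSum, ← Complex.exp_conj]

theorem zSet_zero : zSet 0 = {Fin.elim0} := by decide

theorem zSet_one : zSet 1 = {fun _ => true} := by decide

/-- **Proposition 7.3.** The recurrence relations
`Fₙ = e^{iℓₙσ} F_{n-1} - i cos(π²/(2αₙ)) e^{-iℓₙσ} conj(F̃_{n-1})` and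
`F̃ₙ = e^{iℓₙσ} F̃_{n-1} - i cos(π²/(2αₙ)) e^{-iℓₙσ} conj(F_{n-1})`. -/
theorem stmt14 (m : ℕ) (α ℓ : Fin (m + 1) → ℝ)
    (hα : ∀ j, α j ∈ Set.Ioo 0 Real.pi) (hℓ : ∀ j, 0 < ℓ j) (σ : ℝ) :
    Fc α ℓ σ =
        Complex.exp (Complex.I * ((ℓ (Fin.last m) * σ : ℝ) : ℂ)) *
            Fc (α ∘ Fin.castSucc) (ℓ ∘ Fin.castSucc) σ -
          Complex.I * ((Real.cos (Real.pi ^ 2 / (2 * α (Fin.last m))) : ℝ) : ℂ) *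
            Complex.exp (-(Complex.I * ((ℓ (Fin.last m) * σ : ℝ) : ℂ))) *
            starRingEnd ℂ (Ftc (α ∘ Fin.castSucc) (ℓ ∘ Fin.castSucc) σ) ∧
    Ftc α ℓ σ =
        Complex.exp (Complex.I * ((ℓ (Fin.last m) * σ : ℝ) : ℂ)) *
            Ftc (α ∘ Fin.castSucc) (ℓ ∘ Fin.castSucc) σ -
          Complex.I * ((Real.cos (Real.pi ^ 2 / (2 * α (Fin.last m))) : ℝ) : ℂ) *
            Complex.exp (-(Complex.I * ((ℓ (Fin.last m) * σ : ℝ) : ℂ))) *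
            starRingEnd ℂ (Fc (α ∘ Fin.castSucc) (ℓ ∘ Fin.castSucc) σ) := by
  cases m with
  | zero =>
    have hF : Fc (α ∘ Fin.castSucc) (ℓ ∘ Fin.castSucc) σ = 1 := by
      simp [Fc, zSet_zero, pCoef, dotSgn]
    have hFt : Ftc (α ∘ Fin.castSucc) (ℓ ∘ Fin.castSucc) σ = 0 := by simp [Ftc]
    rw [hF, hFt]
    constructor
    · simp [Fc, zSet_one, pCoef, dotSgn, sgnB]
    · simp [Ftc, zSet_one, qCoef_eq_padCoef, padCoef, dotSgn, sgnB, mul_assoc]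
  | succ k =>
    simp only [Fc_eq_padSum, Ftc_eq_padSum, map_mul, map_neg, Complex.conj_I, conj_padSum,
      neg_neg, padSum_succ _ α ℓ, if_true, Bool.false_eq_true, if_false]
    have hσ : ((ℓ (Fin.last (k + 1)) * -σ : ℝ) : ℂ) =
        -((ℓ (Fin.last (k + 1)) * σ : ℝ) : ℂ) := by
      push_cast
      ring
    constructor
    · ring_nf
      rw [Complex.I_sq]
      ring
    · rw [hσ, mul_neg, neg_neg]
      ring
end

section
/- Let M be a positive integer, T > 0, and let (σ_m)_{m≥1} be a nondecreasing sequence of nonnegative real numbers such that σ_{m+M} = σ_m + T for all m ≥ 1, σ_m ≤ T for all 1 ≤ m ≤ M, and Σ_{m=1}^{M} σ_m = MT/2. Then for every nonnegative integer k, Σ_{m=1}^{∞} max(kT − σ_m, 0) = MTk²/2. (This is the computation of the first Riesz mean at multiples of the period for a periodic quasi-eigenvalue sequence whose elements are symmetrically located within each period, the commensurable-lengths case in the proof of Theorem 2.24 on Riesz means.) -/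
theorem add_mul_period {M : ℕ} {T : ℝ} {σ : ℕ → ℝ} (hper : ∀ m, σ (m + M) = σ m + T)
    (r j : ℕ) : σ (r + j * M) = σ r + j * T := by
  induction j with
  | zero => simp
  | succ j ih =>
    rw [show r + (j + 1) * M = r + j * M + M by ring, hper, ih]
    push_cast
    ring

theorem sum_range_mul_period {M : ℕ} {T : ℝ} {σ : ℕ → ℝ}
    (hper : ∀ m, σ (m + M) = σ m + T) (hsym : ∑ m ∈ Finset.range M, σ m = M * T / 2) (k : ℕ) :
    ∑ m ∈ Finset.range (k * M), σ m = M * T * (k : ℝ) ^ 2 / 2 := by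
  induction k with
  | zero => simp
  | succ k ih =>
    have h : ∀ r, σ (k * M + r) = σ r + k * T := fun r => by
      rw [add_comm, add_mul_period hper]
    rw [Nat.succ_mul, Finset.sum_range_add, ih]
    simp only [h, Finset.sum_add_distrib, hsym, Finset.sum_const, Finset.card_range, nsmul_eq_mul]
    push_cast
    ring

/-- **Riesz mean of a periodic quasi-eigenvalue sequence.** If `(σ_m)` is a nondecreasing
sequence of nonnegative reals with `σ_{m+M} = σ_m + T`, whose first `M` terms lie in `[0,T]`
and are located symmetrically about the midpoint of the period (`Σ_{m<M} σ_m = MT/2`), then for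
every nonnegative integer `k`, `Σ_m (kT - σ_m)_+ = M T k² / 2`. -/
theorem stmt16 (M : ℕ) (hM : 0 < M) (T : ℝ) (hT : 0 < T) (σ : ℕ → ℝ)
    (hnn : ∀ m, 0 ≤ σ m) (hmono : Monotone σ)
    (hper : ∀ m, σ (m + M) = σ m + T)
    (hbd : ∀ m < M, σ m ≤ T)
    (hsym : ∑ m ∈ Finset.range M, σ m = M * T / 2) :
    ∀ k : ℕ, ∑' m : ℕ, max ((k : ℝ) * T - σ m) 0 = M * T * (k : ℝ) ^ 2 / 2 := by
  intro k
  have upper : ∀ m < k * M, σ m ≤ k * T := by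
    intro m hm
    have hj : m / M + 1 ≤ k := (Nat.div_lt_iff_lt_mul hM).2 hm
    have hj' : ((m / M : ℕ) : ℝ) + 1 ≤ k := by exact_mod_cast hj
    have hσ := add_mul_period hper (m % M) (m / M)
    rw [mul_comm, Nat.mod_add_div] at hσ
    have hr := hbd _ (Nat.mod_lt m hM)
    nlinarith [mul_le_mul_of_nonneg_right hj' hT.le]
  have lower : ∀ m, k * M ≤ m → k * T ≤ σ m := by
    intro m hm
    have hσ := add_mul_period hper 0 k
    rw [zero_add] at hσ
    linarith [hmono hm, hnn 0]
  rw [tsum_eq_sum (s := Finset.range (k * M)) fun m hm =>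
    max_eq_right (sub_nonpos.2 (lower m (by simpa using hm)))]
  rw [Finset.sum_congr rfl fun m hm =>
    max_eq_left (sub_nonneg.2 (upper m (Finset.mem_range.1 hm)))]
  rw [Finset.sum_sub_distrib, sum_range_mul_period hper hsym]
  simp only [Finset.sum_const, Finset.card_range, nsmul_eq_mul]
  push_cast
  ring
end

section
/- Let L > 0 and K ≥ 0. There exists a constant C, depending only on K and L, with the following property. Let q, q̃ : [0,L] → ℝ² be three times continuously differentiable unit-speed curves with signed curvatures γ, γ̃, suppose |γ(s)| ≤ K for all s ∈ [0,L], and suppose Γ := sup_{s∈[0,L]} |γ(s) − γ̃(s)| ≤ 1. Then for all s, s' ∈ [0,L]: |q̃''(s)·q̃'(s') − q''(s)·q'(s')| ≤ CΓ|s − s'|, where · denotes the Euclidean inner product on ℝ². (This is Proposition 8.11 of the paper, an auxiliary estimate for the differences of derivatives of single-layer potential kernels on diagonal rectangles.) -/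
/-- Rotation of `ℝ²` by the angle `π/2`. -/
def rot2 (v : ℝ × ℝ) : ℝ × ℝ := (-v.2, v.1)

/-- The Euclidean inner product on `ℝ²`. -/
def dot2 (u v : ℝ × ℝ) : ℝ := u.1 * v.1 + u.2 * v.2

/-- The Euclidean norm on `ℝ²`. -/
noncomputable def enorm2 (v : ℝ × ℝ) : ℝ := Real.sqrt (v.1 ^ 2 + v.2 ^ 2)

/-- The signed curvature of a unit-speed plane curve `q`, i.e. the function `γ` determined by
`q''(s) = γ(s)·Rot(q'(s))`. -/
noncomputable def curv (q : ℝ → ℝ × ℝ) (s : ℝ) : ℝ :=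
  dot2 (iteratedDeriv 2 q s) (rot2 (deriv q s))

/-- The unit tangent of a plane curve, as a complex number. -/
noncomputable def complexTangent (q : ℝ → ℝ × ℝ) (t : ℝ) : ℂ :=
  ⟨(deriv q t).1, (deriv q t).2⟩

theorem hasDerivAt_complex_mk {f g : ℝ → ℝ} {f' g' t : ℝ} (hf : HasDerivAt f f' t)
    (hg : HasDerivAt g g' t) : HasDerivAt (fun x => (⟨f x, g x⟩ : ℂ)) ⟨f', g'⟩ t := by
  simp only [Complex.mk_eq_add_mul_I]
  exact hf.ofReal_comp.add (hg.ofReal_comp.mul_const Complex.I)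

theorem sq_add_sq_eq_one_of_enorm2_eq_one {v : ℝ × ℝ} (h : enorm2 v = 1) :
    v.1 ^ 2 + v.2 ^ 2 = 1 := Real.sqrt_eq_one.mp h

theorem hasDerivAt_deriv_of_contDiff {q : ℝ → ℝ × ℝ} (hq : ContDiff ℝ 3 q) (t : ℝ) :
    HasDerivAt (fun x => (deriv q x).1) (iteratedDeriv 2 q t).1 t ∧
      HasDerivAt (fun x => (deriv q x).2) (iteratedDeriv 2 q t).2 t := by
  have h : Differentiable ℝ (iteratedDeriv 1 q) :=
    hq.differentiable_iteratedDeriv 1 (by norm_num)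
  rw [iteratedDeriv_one] at h
  rw [iteratedDeriv_succ, iteratedDeriv_one]
  exact ⟨(ContinuousLinearMap.fst ℝ ℝ ℝ).hasFDerivAt.comp_hasDerivAt t (h t).hasDerivAt,
    (ContinuousLinearMap.snd ℝ ℝ ℝ).hasFDerivAt.comp_hasDerivAt t (h t).hasDerivAt⟩

/-- The Frenet equation `q'' = γ · Rot q'` for a unit-speed curve. -/
theorem iteratedDeriv_two_eq_curv_smul {L : ℝ} (hL : 0 < L) {q : ℝ → ℝ × ℝ}
    (hq : ContDiff ℝ 3 q) (hu : ∀ s ∈ Set.Icc (0 : ℝ) L, enorm2 (deriv q s) = 1)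
    {t : ℝ} (ht : t ∈ Set.Icc (0 : ℝ) L) :
    (iteratedDeriv 2 q t).1 = -(curv q t * (deriv q t).2) ∧
      (iteratedDeriv 2 q t).2 = curv q t * (deriv q t).1 := by
  obtain ⟨hd1, hd2⟩ := hasDerivAt_deriv_of_contDiff hq t
  have h0 := ((hd1.fun_pow 2).fun_add (hd2.fun_pow 2)).hasDerivWithinAt (s := Set.Icc (0 : ℝ) L)
  have h1 := (hasDerivWithinAt_const t (Set.Icc (0 : ℝ) L) (1 : ℝ)).congr
    (fun x hx => sq_add_sq_eq_one_of_enorm2_eq_one (hu x hx))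
    (sq_add_sq_eq_one_of_enorm2_eq_one (hu t ht))
  have h2 := (uniqueDiffOn_Icc hL t ht).eq_deriv _ h0 h1
  have h3 := sq_add_sq_eq_one_of_enorm2_eq_one (hu t ht)
  norm_num at h2
  simp only [curv, dot2, rot2]
  constructor
  · linear_combination (-(iteratedDeriv 2 q t).1) * h3 + ((deriv q t).1 / 2) * h2
  · linear_combination (-(iteratedDeriv 2 q t).2) * h3 + ((deriv q t).2 / 2) * h2

theorem hasDerivAt_complexTangent {L : ℝ} (hL : 0 < L) {q : ℝ → ℝ × ℝ}
    (hq : ContDiff ℝ 3 q) (hu : ∀ s ∈ Set.Icc (0 : ℝ) L, enorm2 (deriv q s) = 1)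
    {t : ℝ} (ht : t ∈ Set.Icc (0 : ℝ) L) :
    HasDerivAt (complexTangent q) (Complex.I * curv q t * complexTangent q t) t := by
  obtain ⟨hd1, hd2⟩ := hasDerivAt_deriv_of_contDiff hq t
  obtain ⟨h1, h2⟩ := iteratedDeriv_two_eq_curv_smul hL hq hu ht
  have h := hasDerivAt_complex_mk hd1 hd2
  change HasDerivAt (complexTangent q) _ t at h
  convert h using 1
  apply Complex.ext <;> simp [complexTangent, h1, h2]

theorem norm_complexTangent {q : ℝ → ℝ × ℝ} {t : ℝ} (h : enorm2 (deriv q t) = 1) :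
    ‖complexTangent q t‖ = 1 := by
  rw [← h, Complex.norm_def, Complex.normSq_apply, enorm2]
  simp [complexTangent, sq]

theorem dot2_iteratedDeriv_two_deriv {L : ℝ} (hL : 0 < L) {q : ℝ → ℝ × ℝ}
    (hq : ContDiff ℝ 3 q) (hu : ∀ s ∈ Set.Icc (0 : ℝ) L, enorm2 (deriv q s) = 1)
    {s : ℝ} (hs : s ∈ Set.Icc (0 : ℝ) L) (t : ℝ) :
    dot2 (iteratedDeriv 2 q s) (deriv q t) =
      curv q s * (star (complexTangent q s) * complexTangent q t).im := by
  obtain ⟨h1, h2⟩ := iteratedDeriv_two_eq_curv_smul hL hq hu hs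
  simp only [dot2, h1, h2, complexTangent, Complex.star_def, Complex.mul_im, Complex.conj_re,
    Complex.conj_im]
  ring

/-- Two solutions of `u' = i γ u` and `v' = i δ v` on the unit circle drift apart, relative to
their values at `s`, at rate at most `sup |γ - δ|`. -/
theorem norm_star_mul_sub_star_mul_le {S : Set ℝ} (hS : Convex ℝ S) {u v : ℝ → ℂ}
    {γ δ : ℝ → ℝ} {B : ℝ}
    (hu : ∀ t ∈ S, HasDerivAt u (Complex.I * γ t * u t) t)
    (hv : ∀ t ∈ S, HasDerivAt v (Complex.I * δ t * v t) t)
    (hu1 : ∀ t ∈ S, ‖u t‖ = 1) (hv1 : ∀ t ∈ S, ‖v t‖ = 1)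
    (hB : ∀ t ∈ S, |γ t - δ t| ≤ B) {s t : ℝ} (hs : s ∈ S) (ht : t ∈ S) :
    ‖star (v s) * v t - star (u s) * u t‖ ≤ B * |s - t| := by
  have hd : ∀ x ∈ S, HasDerivWithinAt (fun x => star (u x) * v x)
      (Complex.I * ((δ x - γ x : ℝ) : ℂ) * (star (u x) * v x)) S x := by
    intro x hx
    refine ((hu x hx).star.fun_mul (hv x hx)).hasDerivWithinAt.congr_deriv ?_
    rw [star_mul, star_mul, Complex.star_def, Complex.conj_I, Complex.conj_ofReal]
    push_cast
    ring
  have hb : ∀ x ∈ S, ‖Complex.I * ((δ x - γ x : ℝ) : ℂ) * (star (u x) * v x)‖ ≤ B := by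
    intro x hx
    rw [norm_mul, norm_mul, norm_mul, norm_star, hu1 x hx, hv1 x hx, Complex.norm_I,
      Complex.norm_real, Real.norm_eq_abs, abs_sub_comm]
    simpa using hB x hx
  have h := hS.norm_image_sub_le_of_norm_hasDerivWithin_le hd hb hs ht
  rw [Real.norm_eq_abs, abs_sub_comm] at h
  have hus : ∀ x ∈ S, u x * star (u x) = 1 := by
    intro x hx
    rw [Complex.star_def, Complex.mul_conj, Complex.normSq_eq_norm_sq, hu1 x hx]
    simp
  have hvs : v s * star (v s) = 1 := by
    rw [Complex.star_def, Complex.mul_conj, Complex.normSq_eq_norm_sq, hv1 s hs]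
    simp
  have key : star (v s) * v t - star (u s) * u t =
      star (v s) * u t * (star (u t) * v t - star (u s) * v s) := by
    linear_combination (-(star (v s) * v t)) * hus t ht + (u t * star (u s)) * hvs
  rw [key, norm_mul, norm_mul, norm_star, hv1 s hs, hu1 t ht]
  simpa using h

/-- **Proposition 8.11.** There is a constant `C` depending only on `K` and `L` such that for any
two `C³` unit-speed curves `q, q̃ : [0,L] → ℝ²` with signed curvatures `γ, γ̃` satisfying
`|γ| ≤ K` and `sup|γ - γ̃| ≤ Γ ≤ 1`, one has for all `s, s' ∈ [0,L]`:
`|q̃''(s)·q̃'(s') - q''(s)·q'(s')| ≤ CΓ|s - s'|`. -/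
theorem stmt18 (L K : ℝ) (hL : 0 < L) (hK : 0 ≤ K) :
    ∃ C : ℝ, ∀ (q qt : ℝ → ℝ × ℝ) (Γ : ℝ),
      ContDiff ℝ 3 q → ContDiff ℝ 3 qt →
      (∀ s ∈ Set.Icc (0 : ℝ) L, enorm2 (deriv q s) = 1) →
      (∀ s ∈ Set.Icc (0 : ℝ) L, enorm2 (deriv qt s) = 1) →
      (∀ s ∈ Set.Icc (0 : ℝ) L, |curv q s| ≤ K) →
      (∀ s ∈ Set.Icc (0 : ℝ) L, |curv q s - curv qt s| ≤ Γ) →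
      Γ ≤ 1 →
      ∀ s ∈ Set.Icc (0 : ℝ) L, ∀ s' ∈ Set.Icc (0 : ℝ) L,
        |dot2 (iteratedDeriv 2 qt s) (deriv qt s') - dot2 (iteratedDeriv 2 q s) (deriv q s')|
          ≤ C * Γ * |s - s'| := by
  refine ⟨2 * K + 1, ?_⟩
  intro q qt Γ hq hqt hu hut hK' hΓ hΓ1 s hs t ht
  have hΓ0 : 0 ≤ Γ := (abs_nonneg _).trans (hΓ s hs)
  rw [dot2_iteratedDeriv_two_deriv hL hq hu hs, dot2_iteratedDeriv_two_deriv hL hqt hut hs]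
  have hd := fun x hx => hasDerivAt_complexTangent hL hq hu (t := x) hx
  have hdt := fun x hx => hasDerivAt_complexTangent hL hqt hut (t := x) hx
  have h1 := norm_star_mul_sub_star_mul_le (convex_Icc 0 L) hd hdt
    (fun x hx => norm_complexTangent (hu x hx)) (fun x hx => norm_complexTangent (hut x hx))
    hΓ hs ht
  have h2 := norm_star_mul_sub_star_mul_le (u := fun _ => 1) (γ := fun _ => 0) (B := K + 1)
    (convex_Icc 0 L) (fun x _ => by simpa using hasDerivAt_const x (1 : ℂ)) hdt
    (fun _ _ => by simp) (fun x hx => norm_complexTangent (hut x hx))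
    (fun x hx => by
      have h3 := abs_le.mp (hK' x hx)
      have h4 := abs_le.mp (hΓ x hx)
      rw [abs_le]
      constructor <;> linarith) hs ht
  have h1' := (Complex.abs_im_le_norm _).trans h1
  have h2' := (Complex.abs_im_le_norm _).trans h2
  simp only [Complex.sub_im, star_one, mul_one, Complex.one_im, sub_zero] at h1' h2'
  set a := (star (complexTangent q s) * complexTangent q t).im
  set b := (star (complexTangent qt s) * complexTangent qt t).im
  calc |curv qt s * b - curv q s * a|
      = |(curv q s * (b - a)) - (curv q s - curv qt s) * b| := by ring_nf
    _ ≤ |curv q s * (b - a)| + |(curv q s - curv qt s) * b| := abs_sub _ _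
    _ = |curv q s| * |b - a| + |curv q s - curv qt s| * |b| := by rw [abs_mul, abs_mul]
    _ ≤ K * (Γ * |s - t|) + Γ * ((K + 1) * |s - t|) := by
        gcongr
        · exact hK' s hs
        · exact hΓ s hs
    _ = (2 * K + 1) * Γ * |s - t| := by ring
end
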